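/- For networks N_X = (X, r_X) and N_Y = (Y, r_Y), the embedding distance satisfies d_E(N_X, N_Y) = 0 if and only if N_X and N_Y are isomorphic. -/

import Mathlib

open scoped BigOperators

/-- Network difference of a map `φ : X → Y` between networks `(X, rX)` and `(Y, rY)`:
`Δ_{X,Y}(φ) = max_{x,x'} |rX x x' - rY (φ x) (φ x')|`. -/
noncomputable def netDiff {X Y : Type*} (rX : X → X → ℝ)
    (rY : Y → Y → ℝ) (φ : X → Y) : ℝ :=
  ⨆ x : X, ⨆ x' : X, |rX x x' - rY (φ x) (φ x')|

/-- Partial embedding distance `d_PE(N_X, N_Y) = min_{φ : X → Y} Δ_{X,Y}(φ)`. -/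
noncomputable def dPE {X Y : Type*} (rX : X → X → ℝ) (rY : Y → Y → ℝ) : ℝ :=
  ⨅ φ : X → Y, netDiff rX rY φ

/-- Embedding distance `d_E(N_X, N_Y) = max {d_PE(N_X, N_Y), d_PE(N_Y, N_X)}`. -/
noncomputable def dE {X Y : Type*} (rX : X → X → ℝ) (rY : Y → Y → ℝ) : ℝ :=
  max (dPE rX rY) (dPE rY rX)

section NetworkDistance

variable {X Y : Type*}

lemma netDiff_nonneg (rX : X → X → ℝ) (rY : Y → Y → ℝ) (φ : X → Y) :
    0 ≤ netDiff rX rY φ :=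
  Real.iSup_nonneg fun _ => Real.iSup_nonneg fun _ => abs_nonneg _

lemma netDiff_eq_zero_iff [Finite X] (rX : X → X → ℝ) (rY : Y → Y → ℝ) (φ : X → Y) :
    netDiff rX rY φ = 0 ↔ ∀ x x', rX x x' = rY (φ x) (φ x') := by
  refine ⟨fun h x x' => ?_, fun h => by simp [netDiff, h]⟩
  have h₁ : |rX x x' - rY (φ x) (φ x')| ≤ ⨆ x', |rX x x' - rY (φ x) (φ x')| :=
    le_ciSup (f := fun x' => |rX x x' - rY (φ x) (φ x')|) (Set.finite_range _).bddAbove x'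
  have h₂ : ⨆ x', |rX x x' - rY (φ x) (φ x')| ≤ netDiff rX rY φ :=
    le_ciSup (f := fun x => ⨆ x', |rX x x' - rY (φ x) (φ x')|) (Set.finite_range _).bddAbove x
  exact sub_eq_zero.mp (abs_nonpos_iff.mp ((h₁.trans h₂).trans h.le))

lemma dPE_nonneg (rX : X → X → ℝ) (rY : Y → Y → ℝ) : 0 ≤ dPE rX rY :=
  Real.iInf_nonneg fun φ => netDiff_nonneg rX rY φ

lemma dPE_eq_zero_iff [Finite X] [Finite Y] [Nonempty Y] (rX : X → X → ℝ) (rY : Y → Y → ℝ) :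
    dPE rX rY = 0 ↔ ∃ φ : X → Y, ∀ x x', rX x x' = rY (φ x) (φ x') := by
  constructor
  · intro h
    obtain ⟨φ, hφ⟩ := exists_eq_ciInf_of_finite (f := fun φ : X → Y => netDiff rX rY φ)
    exact ⟨φ, (netDiff_eq_zero_iff rX rY φ).mp (hφ.trans h)⟩
  · rintro ⟨φ, hφ⟩
    refine le_antisymm ?_ (dPE_nonneg rX rY)
    rw [← (netDiff_eq_zero_iff rX rY φ).mpr hφ]
    exact ciInf_le (Set.finite_range _).bddBelow φ

lemma dE_eq_zero_iff (rX : X → X → ℝ) (rY : Y → Y → ℝ) :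
    dE rX rY = 0 ↔ dPE rX rY = 0 ∧ dPE rY rX = 0 := by
  have hX := dPE_nonneg rX rY
  have hY := dPE_nonneg rY rX
  rw [dE, ← (le_max_of_le_left hX).ge_iff_eq', max_le_iff, hX.ge_iff_eq', hY.ge_iff_eq']

lemma injective_of_forall_eq {rX : X → X → ℝ} {rY : Y → Y → ℝ}
    (hX : ∀ x x', rX x x' = 0 → x = x') (hY : ∀ y, rY y y = 0) {φ : X → Y}
    (h : ∀ x x', rX x x' = rY (φ x) (φ x')) : Function.Injective φ :=
  fun x x' hxx' => hX x x' (by rw [h, hxx', hY])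

end NetworkDistance

/-- the embedding distance vanishes iff the networks are isomorphic. -/
theorem embedding_distance_eq_zero_iff_isomorphic
    {X Y : Type*} [Fintype X] [Nonempty X] [Fintype Y] [Nonempty Y]
(rX : X → X → ℝ) (rY : Y → Y → ℝ)
    (hX0 : ∀ x x', 0 ≤ rX x x') (hXsymm : ∀ x x', rX x x' = rX x' x)
    (hXid : ∀ x x', rX x x' = 0 ↔ x = x')
    (hY0 : ∀ y y', 0 ≤ rY y y') (hYsymm : ∀ y y', rY y y' = rY y' y)
    (hYid : ∀ y y', rY y y' = 0 ↔ y = y') :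
    dE rX rY = 0 ↔
      ∃ φ : X → Y, Function.Bijective φ ∧ ∀ x x', rX x x' = rY (φ x) (φ x') := by
  rw [dE_eq_zero_iff, dPE_eq_zero_iff, dPE_eq_zero_iff]
  constructor
  · rintro ⟨⟨φ, hφ⟩, ψ, hψ⟩
    have hφ_inj : Function.Injective φ :=
      injective_of_forall_eq (fun x x' => (hXid x x').mp) (fun y => (hYid y y).mpr rfl) hφ
    have hψ_inj : Function.Injective ψ :=
      injective_of_forall_eq (fun y y' => (hYid y y').mp) (fun x => (hXid x x).mpr rfl) hψ
    exact ⟨φ, (Fintype.bijective_iff_injective_and_card φ).mpr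
      ⟨hφ_inj, (Fintype.card_le_of_injective φ hφ_inj).antisymm
        (Fintype.card_le_of_injective ψ hψ_inj)⟩, hφ⟩
  · rintro ⟨φ, hφ_bij, hφ⟩
    obtain ⟨ψ, -, hψ⟩ := Function.bijective_iff_has_inverse.mp hφ_bij
    exact ⟨⟨φ, hφ⟩, ψ, fun y y' => by rw [hφ, hψ, hψ]⟩
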